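/- Let Ax ⊆ {em, t□, str, p_a}, where em := p∨¬p, t□ := (⊤⇛p)→p, str := (p→q)→(p⇛q), p_a := (p⇛q)→(⊤⇛(p⇛q)). Then HLC♭⊕Ax is sound and strongly complete with respect to the class of flat frames validating every formula of Ax: for all Γ ∪ {φ} ⊆ L⇛, Γ ⊢_Ax φ if and only if every flat frame validating every formula of Ax validates the consecution Γ ⇒ φ. -/

import Mathlib

/-- Formulas of the language `L⇛`. -/
inductive Fml : Type where
  | var : Nat → Fml
  | top : Fml
  | bot : Fml
  | and : Fml → Fml → Fml
  | or  : Fml → Fml → Fml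
  | imp : Fml → Fml → Fml
  | sto : Fml → Fml → Fml
deriving DecidableEq

/-- Uniform substitution. -/
def Fml.subst (σ : Nat → Fml) : Fml → Fml
  | .var p => σ p
  | .top => .top
  | .bot => .bot
  | .and φ ψ => .and (φ.subst σ) (ψ.subst σ)
  | .or φ ψ => .or (φ.subst σ) (ψ.subst σ)
  | .imp φ ψ => .imp (φ.subst σ) (ψ.subst σ)
  | .sto φ ψ => .sto (φ.subst σ) (ψ.subst σ)

/-- Conjunction `φ₁ ∧ ⋯ ∧ φₙ` of a list of formulas (`⊤` for the empty list). -/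
def Fml.conj : List Fml → Fml
  | [] => .top
  | [φ] => φ
  | φ :: ψ :: rest => .and φ (Fml.conj (ψ :: rest))

/-- Disjunction `φ₁ ∨ ⋯ ∨ φₙ` of a list of formulas (`⊥` for the empty list). -/
def Fml.disj : List Fml → Fml
  | [] => .bot
  | [φ] => φ
  | φ :: ψ :: rest => .or φ (Fml.disj (ψ :: rest))

/-- Axiom schemes of intuitionistic propositional logic (a standard Hilbert-style
axiomatisation); as schemes, they comprise all substitution instances. -/
inductive IpcAx : Fml → Prop where
  | k (φ ψ : Fml) : IpcAx (.imp φ (.imp ψ φ))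
  | s (φ ψ χ : Fml) : IpcAx (.imp (.imp φ (.imp ψ χ)) (.imp (.imp φ ψ) (.imp φ χ)))
  | andE1 (φ ψ : Fml) : IpcAx (.imp (.and φ ψ) φ)
  | andE2 (φ ψ : Fml) : IpcAx (.imp (.and φ ψ) ψ)
  | andI (φ ψ : Fml) : IpcAx (.imp φ (.imp ψ (.and φ ψ)))
  | orI1 (φ ψ : Fml) : IpcAx (.imp φ (.or φ ψ))
  | orI2 (φ ψ : Fml) : IpcAx (.imp ψ (.or φ ψ))
  | orE (φ ψ χ : Fml) : IpcAx (.imp (.imp φ χ) (.imp (.imp ψ χ) (.imp (.or φ ψ) χ)))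
  | botE (φ : Fml) : IpcAx (.imp .bot φ)
  | top : IpcAx .top

/-- Substitution instances of the axioms of intuitionistic logic together with
`k_a : ((p⇛q)∧(p⇛r))→(p⇛(q∧r))` and `tr : ((p⇛q)∧(q⇛r))→(p⇛r)`. -/
inductive BaseAx : Fml → Prop where
  | ipc {φ : Fml} : IpcAx φ → BaseAx φ
  | ka (φ ψ χ : Fml) : BaseAx (.imp (.and (.sto φ ψ) (.sto φ χ)) (.sto φ (.and ψ χ)))
  | tr (φ ψ χ : Fml) : BaseAx (.imp (.and (.sto φ ψ) (.sto ψ χ)) (.sto φ χ))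

/-- Derivability of the consecution `Γ ⇒ φ` in `HLC♭ ⊕ Ax`, i.e. `Γ ⊢_Ax φ`. -/
inductive Deriv (Ax : Set Fml) : Set Fml → Fml → Prop where
  | base {Γ : Set Fml} {φ : Fml} : BaseAx φ → Deriv Ax Γ φ
  | axm {Γ : Set Fml} {ψ : Fml} (σ : Nat → Fml) : ψ ∈ Ax → Deriv Ax Γ (ψ.subst σ)
  | el {Γ : Set Fml} {φ : Fml} : φ ∈ Γ → Deriv Ax Γ φ
  | mp {Γ : Set Fml} {φ ψ : Fml} : Deriv Ax Γ φ → Deriv Ax Γ (.imp φ ψ) → Deriv Ax Γ ψ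
  | na {Γ : Set Fml} {φ ψ : Fml} : Deriv Ax (∅ : Set Fml) (.imp φ ψ) → Deriv Ax Γ (.sto φ ψ)

/-- A flat frame: a nonempty set of worlds with a preorder `≼` and a relation `R`. -/
structure FlatFrame : Type 1 where
  W : Type
  ne : Nonempty W
  le : W → W → Prop
  le_refl : ∀ w, le w w
  le_trans : ∀ ⦃w v u⦄, le w v → le v u → le w u
  R : W → W → Prop

/-- A valuation is admissible if every proposition letter denotes an upset. -/
def FlatFrame.IsUpset (F : FlatFrame) (V : Nat → F.W → Prop) : Prop :=
  ∀ p ⦃w v⦄, F.le w v → V p w → V p v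

/-- Truth of a formula at a world of a flat model: the usual intuitionistic Kripke
clauses over `≼`, and `w ⊨ φ⇛ψ` iff for every `w' ≽ w`, `R[w'] ⊆ ⟦φ⟧` implies
`R[w'] ⊆ ⟦ψ⟧`. -/
def FlatFrame.sat (F : FlatFrame) (V : Nat → F.W → Prop) : Fml → F.W → Prop
  | .var p, w => V p w
  | .top, _ => True
  | .bot, _ => False
  | .and φ ψ, w => F.sat V φ w ∧ F.sat V ψ w
  | .or φ ψ, w => F.sat V φ w ∨ F.sat V ψ w
  | .imp φ ψ, w => ∀ v, F.le w v → F.sat V φ v → F.sat V ψ v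
  | .sto φ ψ, w => ∀ w', F.le w w' →
      (∀ v, F.R w' v → F.sat V φ v) → ∀ v, F.R w' v → F.sat V ψ v

/-- A flat frame validates the consecution `Γ ⇒ φ` if in every model on it, every
world satisfying all formulas of `Γ` satisfies `φ`. -/
def FlatFrame.ValidCons (F : FlatFrame) (Γ : Set Fml) (φ : Fml) : Prop :=
  ∀ V, F.IsUpset V → ∀ w, (∀ ψ ∈ Γ, F.sat V ψ w) → F.sat V φ w

/-- A flat frame validates a formula if it is true at every world in every model on it. -/
def FlatFrame.ValidFml (F : FlatFrame) (φ : Fml) : Prop :=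
  ∀ V, F.IsUpset V → ∀ w, F.sat V φ w

/-- `em := p ∨ ¬p` (where `¬φ` abbreviates `φ→⊥`). -/
def emFml : Fml := .or (.var 0) (.imp (.var 0) .bot)
/-- `t□ := (⊤⇛p)→p`. -/
def tbFml : Fml := .imp (.sto .top (.var 0)) (.var 0)
/-- `str := (p→q)→(p⇛q)`. -/
def strFml : Fml := .imp (.imp (.var 0) (.var 1)) (.sto (.var 0) (.var 1))
/-- `p_a := (p⇛q)→(⊤⇛(p⇛q))`. -/
def paFml : Fml := .imp (.sto (.var 0) (.var 1)) (.sto .top (.sto (.var 0) (.var 1)))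
/-- `4a := p⇛(⊤⇛p)`. -/
def fourAFml : Fml := .sto (.var 0) (.sto .top (.var 0))
/-- `di := ((p⇛r)∧(q⇛r))→((p∨q)⇛r)`. -/
def diFml : Fml := .imp (.and (.sto (.var 0) (.var 2)) (.sto (.var 1) (.var 2)))
    (.sto (.or (.var 0) (.var 1)) (.var 2))

namespace Deriv

variable {Ax Γ Δ : Set Fml} {φ ψ χ : Fml}

theorem mono (h : Deriv Ax Γ φ) (hs : Γ ⊆ Δ) : Deriv Ax Δ φ := by
  induction h with
  | base h => exact .base h
  | axm σ h => exact .axm σ h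
  | el h => exact .el (hs h)
  | mp _ _ ih₁ ih₂ => exact .mp (ih₁ hs) (ih₂ hs)
  | na h _ => exact .na h

theorem ipc (h : IpcAx φ) : Deriv Ax Γ φ := .base (.ipc h)

theorem imp_of (h : Deriv Ax Γ φ) : Deriv Ax Γ (.imp ψ φ) := .mp h (ipc (.k _ _))

theorem imp_self : Deriv Ax Γ (.imp φ φ) :=
  .mp (ipc (.k φ φ)) (.mp (ipc (.k φ (.imp φ φ))) (ipc (.s _ _ _)))

theorem and_intro (h₁ : Deriv Ax Γ φ) (h₂ : Deriv Ax Γ ψ) : Deriv Ax Γ (.and φ ψ) :=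
  .mp h₂ (.mp h₁ (ipc (.andI _ _)))

theorem deduction (h : Deriv Ax (insert φ Γ) ψ) : Deriv Ax Γ (.imp φ ψ) := by
  generalize hΔ : insert φ Γ = Δ at h
  induction h with
  | base h => exact imp_of (.base h)
  | axm σ h => exact imp_of (.axm σ h)
  | el h =>
    subst hΔ
    rcases h with rfl | h
    · exact imp_self
    · exact imp_of (.el h)
  | mp _ _ ih₁ ih₂ => exact .mp (ih₁ hΔ) (.mp (ih₂ hΔ) (ipc (.s _ _ _)))
  | na h _ => exact imp_of (.na h)

theorem sto_intro_right (h : Deriv Ax ∅ ψ) : Deriv Ax Γ (.sto φ ψ) := .na (imp_of h)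

theorem sto_mp (h₁ : Deriv Ax Γ (.sto φ ψ)) (h₂ : Deriv Ax Γ (.sto φ (.imp ψ χ))) :
    Deriv Ax Γ (.sto φ χ) := by
  have h₃ : Deriv Ax ∅ (.imp (.and ψ (.imp ψ χ)) χ) := by
    apply deduction
    have h := Deriv.el (Ax := Ax) (Set.mem_insert (Fml.and ψ (.imp ψ χ)) ∅)
    exact .mp (.mp h (ipc (.andE1 _ _))) (.mp h (ipc (.andE2 _ _)))
  exact .mp (and_intro (.mp (and_intro h₁ h₂) (.base (.ka _ _ _))) (.na h₃)) (.base (.tr _ _ _))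

theorem exists_mem_of_sUnion {c : Set (Set Fml)} (hc : IsChain (· ⊆ ·) c) (hne : c.Nonempty)
    (h : Deriv Ax (⋃₀ c) φ) : ∃ s ∈ c, Deriv Ax s φ := by
  generalize hΔ : ⋃₀ c = Δ at h
  obtain ⟨s₀, hs₀⟩ := hne
  induction h with
  | base h => exact ⟨s₀, hs₀, .base h⟩
  | axm σ h => exact ⟨s₀, hs₀, .axm σ h⟩
  | el h =>
    subst hΔ
    obtain ⟨s, hs, hφ⟩ := h
    exact ⟨s, hs, .el hφ⟩
  | mp _ _ ih₁ ih₂ =>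
    obtain ⟨s, hs, h₁⟩ := ih₁ hΔ
    obtain ⟨t, ht, h₂⟩ := ih₂ hΔ
    rcases hc.total hs ht with hst | hts
    · exact ⟨t, ht, .mp (h₁.mono hst) h₂⟩
    · exact ⟨s, hs, .mp h₁ (h₂.mono hts)⟩
  | na h _ => exact ⟨s₀, hs₀, .na h⟩

end Deriv

namespace FlatFrame

variable {F : FlatFrame} {V : Nat → F.W → Prop}

theorem sat_mono (hV : F.IsUpset V) {φ : Fml} {w v : F.W} (hwv : F.le w v)
    (h : F.sat V φ w) : F.sat V φ v := by
  induction φ with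
  | var p => exact hV p hwv h
  | top => trivial
  | bot => exact h
  | and φ ψ ih₁ ih₂ => exact ⟨ih₁ h.1, ih₂ h.2⟩
  | or φ ψ ih₁ ih₂ => exact h.imp ih₁ ih₂
  | imp φ ψ _ _ => exact fun u hu => h u (F.le_trans hwv hu)
  | sto φ ψ _ _ => exact fun u hu => h u (F.le_trans hwv hu)

theorem sat_subst (σ : Nat → Fml) (φ : Fml) (w : F.W) :
    F.sat V (φ.subst σ) w ↔ F.sat (fun p => F.sat V (σ p)) φ w := by
  induction φ generalizing w with
  | var p => rfl
  | top => rfl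
  | bot => rfl
  | and φ ψ ih₁ ih₂ => simp only [Fml.subst, sat, ih₁, ih₂]
  | or φ ψ ih₁ ih₂ => simp only [Fml.subst, sat, ih₁, ih₂]
  | imp φ ψ ih₁ ih₂ => simp only [Fml.subst, sat, ih₁, ih₂]
  | sto φ ψ ih₁ ih₂ => simp only [Fml.subst, sat, ih₁, ih₂]

theorem validFml_of_baseAx {φ : Fml} (h : BaseAx φ) : F.ValidFml φ := by
  intro V hV w
  cases h with
  | ipc h =>
    cases h with
    | k φ ψ => exact fun v _ hφ u hvu _ => sat_mono hV hvu hφ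
    | s φ ψ χ =>
      exact fun v _ h u hvu h' x hux hx =>
        h x (F.le_trans hvu hux) hx x (F.le_refl x) (h' x hux hx)
    | andE1 φ ψ => exact fun v _ h => h.1
    | andE2 φ ψ => exact fun v _ h => h.2
    | andI φ ψ => exact fun v _ hφ u hvu hψ => ⟨sat_mono hV hvu hφ, hψ⟩
    | orI1 φ ψ => exact fun v _ h => Or.inl h
    | orI2 φ ψ => exact fun v _ h => Or.inr h
    | orE φ ψ χ =>
      exact fun v _ h u hvu h' x hux hx =>
        hx.elim (h x (F.le_trans hvu hux)) (h' x hux)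
    | botE φ => exact fun v _ h => h.elim
    | top => trivial
  | ka φ ψ χ => exact fun v _ h u hvu hφ x hux => ⟨h.1 u hvu hφ x hux, h.2 u hvu hφ x hux⟩
  | tr φ ψ χ => exact fun v _ h u hvu hφ => h.2 u hvu (h.1 u hvu hφ)

theorem validCons_of_deriv {Ax Γ : Set Fml} {φ : Fml} (hF : ∀ ψ ∈ Ax, F.ValidFml ψ)
    (h : Deriv Ax Γ φ) : F.ValidCons Γ φ := by
  intro V hV
  induction h with
  | base h => exact fun w _ => validFml_of_baseAx h V hV w
  | axm σ h =>
    exact fun w _ => (sat_subst σ _ w).2 (hF _ h (fun p => F.sat V (σ p)) (fun _ _ _ => sat_mono hV) w)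
  | el h => exact fun w hw => hw _ h
  | mp _ _ ih₁ ih₂ => exact fun w hw => ih₂ w hw w (F.le_refl w) (ih₁ w hw)
  | na _ ih =>
    exact fun w _ u _ hφ v huv => ih v (fun _ h => h.elim) v (F.le_refl v) (hφ v huv)

theorem validFml_em (h : ∀ ⦃w v⦄, F.le w v → F.le v w) : F.ValidFml emFml := by
  intro V hV w
  by_cases hw : V 0 w
  · exact Or.inl hw
  · exact Or.inr fun v hwv hv => hw (hV 0 (h hwv) hv)

theorem validFml_tb (h : ∀ w, ∃ u v, F.le w u ∧ F.R u v ∧ F.le v w) : F.ValidFml tbFml := by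
  intro V hV _ w _ hw
  obtain ⟨u, v, hwu, huv, hvw⟩ := h w
  exact hV 0 hvw (hw u hwu (fun _ _ => trivial) v huv)

theorem validFml_str (h : ∀ ⦃w v⦄, F.R w v → F.le w v) : F.ValidFml strFml :=
  fun _ _ _ _ _ hw _ hwu hu v huv => hw v (F.le_trans hwu (h huv)) (hu v huv)

theorem validFml_pa
    (h : ∀ ⦃w v v'⦄, F.R w v → F.le v v' → ∃ u, F.le w u ∧ ∀ x, F.R u x ↔ F.R v' x) :
    F.ValidFml paFml := by
  intro V _ _ w _ hw w' hww' _ v hv v' hvv' hp x hx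
  obtain ⟨_, hu, hR⟩ := h hv hvv'
  exact hw _ (F.le_trans hww' hu) (fun y hy => hp y ((hR y).1 hy)) x ((hR x).2 hx)

end FlatFrame

/-- A deductively closed set of formulas. -/
def IsTheory (Ax Φ : Set Fml) : Prop := ∀ ⦃φ⦄, Deriv Ax Φ φ → φ ∈ Φ

/-- A consistent deductively closed set of formulas with the disjunction property. -/
structure IsPrimeTheory (Ax Δ : Set Fml) : Prop where
  isTheory : IsTheory Ax Δ
  bot_notMem : Fml.bot ∉ Δ
  mem_or_mem : ∀ ⦃φ ψ⦄, Fml.or φ ψ ∈ Δ → φ ∈ Δ ∨ ψ ∈ Δ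

section Canonical

variable {Ax Γ Δ Φ : Set Fml} {φ ψ : Fml}

theorem IsTheory.mp (h : IsTheory Ax Φ) (h₁ : φ ∈ Φ) (h₂ : Fml.imp φ ψ ∈ Φ) : ψ ∈ Φ :=
  h (.mp (.el h₁) (.el h₂))

theorem IsTheory.ipc_mp (h : IsTheory Ax Φ) (h₁ : φ ∈ Φ) (h₂ : IpcAx (.imp φ ψ)) : ψ ∈ Φ :=
  h (.mp (.el h₁) (.ipc h₂))

theorem IsTheory.subst_mem (h : IsTheory Ax Φ) (hφ : φ ∈ Ax) (σ : Nat → Fml) : φ.subst σ ∈ Φ :=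
  h (.axm σ hφ)

/-- Every underivable consecution is refuted by a prime theory. -/
theorem exists_isPrimeTheory (h : ¬ Deriv Ax Γ φ) :
    ∃ Δ, Γ ⊆ Δ ∧ IsPrimeTheory Ax Δ ∧ φ ∉ Δ := by
  obtain ⟨Δ, hΓΔ, hΔ⟩ := zorn_subset_nonempty {Δ | ¬ Deriv Ax Δ φ}
    (fun c hc hchain hne => ⟨⋃₀ c, fun hd => by
      obtain ⟨s, hs, hd⟩ := hd.exists_mem_of_sUnion hchain hne
      exact hc hs hd, fun s hs => Set.subset_sUnion_of_mem hs⟩) Γ h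
  have hnot : ¬ Deriv Ax Δ φ := hΔ.prop
  have key : ∀ ψ, ψ ∈ Δ ∨ Deriv Ax Δ (.imp ψ φ) := by
    intro ψ
    by_contra! hcon
    exact hcon.1 (hΔ.le_of_ge (y := insert ψ Δ) (fun hd => hcon.2 hd.deduction)
      (Set.subset_insert _ _) (Set.mem_insert _ _))
  refine ⟨Δ, hΓΔ, ⟨fun ψ hψ => ?_, fun hbot => hnot (.mp (.el hbot) (.ipc (.botE _))),
    fun ψ χ hor => ?_⟩, fun hφ => hnot (.el hφ)⟩
  · exact (key ψ).resolve_right fun hd => hnot (.mp hψ hd)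
  · by_contra! hcon
    exact hnot (.mp (.el hor) (.mp ((key χ).resolve_left hcon.2)
      (.mp ((key ψ).resolve_left hcon.1) (.ipc (.orE _ _ _)))))

/-- The consequences of `φ` under the strict implications in `Δ`. -/
def stoConsequences (Δ : Set Fml) (φ : Fml) : Set Fml := {χ | Fml.sto φ χ ∈ Δ}

theorem isTheory_stoConsequences (hΔ : IsTheory Ax Δ) (φ : Fml) :
    IsTheory Ax (stoConsequences Δ φ) := by
  intro χ h
  generalize hΘ : stoConsequences Δ φ = Θ at h ⊢
  have hmem : ∀ ψ, ψ ∈ Θ ↔ Deriv Ax Δ (.sto φ ψ) := fun ψ => by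
    rw [← hΘ]
    exact ⟨fun h => .el h, fun h => hΔ h⟩
  clear hΘ
  rw [hmem]
  induction h with
  | base h => exact .sto_intro_right (.base h)
  | axm σ h => exact .sto_intro_right (.axm σ h)
  | el h => exact (hmem _).1 h
  | mp _ _ ih₁ ih₂ => exact .sto_mp (ih₁ hmem) (ih₂ hmem)
  | na h _ => exact .sto_intro_right (.na h)

theorem mem_stoConsequences_of_sto (hΔ : IsTheory Ax Δ) {χ : Fml} (h : Fml.sto ψ χ ∈ Δ)
    (hψ : ψ ∈ stoConsequences Δ φ) : χ ∈ stoConsequences Δ φ :=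
  hΔ (.mp (.and_intro (.el hψ) (.el h)) (.base (.tr _ _ _)))

theorem self_mem_stoConsequences (hΔ : IsTheory Ax Δ) : φ ∈ stoConsequences Δ φ :=
  hΔ (.na .imp_self)

/-- A world of the canonical model: a prime theory `base`, together with a theory `succ`
closed under the strict implications in `base`, which determines the `R`-successors. -/
structure CanonicalWorld (Ax : Set Fml) where
  base : Set Fml
  succ : Set Fml
  prime : IsPrimeTheory Ax base
  isTheory_succ : IsTheory Ax succ
  mem_of_sto : ∀ ⦃φ ψ⦄, Fml.sto φ ψ ∈ base → φ ∈ succ → ψ ∈ succ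

namespace CanonicalWorld

/-- The world over the prime theory `Δ` whose successors are given by the
consequences of `φ`. -/
def ofConsequences (hΔ : IsPrimeTheory Ax Δ) (φ : Fml) : CanonicalWorld Ax where
  base := Δ
  succ := stoConsequences Δ φ
  prime := hΔ
  isTheory_succ := isTheory_stoConsequences hΔ.isTheory φ
  mem_of_sto _ _ := mem_stoConsequences_of_sto hΔ.isTheory

theorem mem_succ_of_top_sto (w : CanonicalWorld Ax) (h : Fml.sto .top φ ∈ w.base) : φ ∈ w.succ :=
  w.mem_of_sto h (w.isTheory_succ (.ipc .top))

/-- The flat frame of canonical worlds. -/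
def frame (Ax : Set Fml) [Nonempty (CanonicalWorld Ax)] : FlatFrame where
  W := CanonicalWorld Ax
  ne := inferInstance
  le w v := w.base ⊆ v.base
  le_refl _ := subset_rfl
  le_trans _ _ _ := Set.Subset.trans
  R w v := w.succ ⊆ v.base

/-- The canonical valuation. -/
def val (p : Nat) (w : CanonicalWorld Ax) : Prop := Fml.var p ∈ w.base

variable [Nonempty (CanonicalWorld Ax)]

theorem sat_iff_mem (φ : Fml) (w : CanonicalWorld Ax) :
    (frame Ax).sat val φ w ↔ φ ∈ w.base := by
  induction φ generalizing w with
  | var p => rfl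
  | top => exact iff_of_true trivial (w.prime.isTheory (.ipc .top))
  | bot => exact iff_of_false id w.prime.bot_notMem
  | and φ ψ ih₁ ih₂ =>
    simp only [FlatFrame.sat, ih₁, ih₂]
    have hw := w.prime.isTheory
    exact ⟨fun h => hw (.and_intro (.el h.1) (.el h.2)),
      fun h => ⟨hw.ipc_mp h (.andE1 _ _), hw.ipc_mp h (.andE2 _ _)⟩⟩
  | or φ ψ ih₁ ih₂ =>
    simp only [FlatFrame.sat, ih₁, ih₂]
    have hw := w.prime.isTheory
    exact ⟨fun h => h.elim (fun h => hw.ipc_mp h (.orI1 _ _)) (fun h => hw.ipc_mp h (.orI2 _ _)),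
      fun h => w.prime.mem_or_mem h⟩
  | imp φ ψ ih₁ ih₂ =>
    refine ⟨fun h => ?_, fun h v hwv hv =>
      (ih₂ v).2 (v.prime.isTheory.mp ((ih₁ v).1 hv) (hwv h))⟩
    by_contra hcon
    obtain ⟨Δ, hsub, hΔ, hψ⟩ := exists_isPrimeTheory (Ax := Ax) (Γ := insert φ w.base) (φ := ψ)
      fun hd => hcon (w.prime.isTheory hd.deduction)
    let v := ofConsequences hΔ .top
    exact hψ ((ih₂ v).1 (h v ((Set.subset_insert _ _).trans hsub)
      ((ih₁ v).2 (hsub (Set.mem_insert _ _)))))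
  | sto φ ψ ih₁ ih₂ =>
    have key : ∀ (χ : Fml) (u : CanonicalWorld Ax),
        (∀ v : CanonicalWorld Ax, u.succ ⊆ v.base → χ ∈ v.base) ↔ χ ∈ u.succ := by
      refine fun χ u => ⟨fun h => ?_, fun h v hv => hv h⟩
      by_contra hcon
      obtain ⟨Δ, hsub, hΔ, hχ⟩ := exists_isPrimeTheory fun hd => hcon (u.isTheory_succ hd)
      exact hχ (h (ofConsequences hΔ .top) hsub)
    have hsat : (frame Ax).sat val (.sto φ ψ) w ↔
        ∀ u : CanonicalWorld Ax, w.base ⊆ u.base → φ ∈ u.succ → ψ ∈ u.succ := by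
      refine forall_congr' fun u => imp_congr Iff.rfl ?_
      rw [← key φ u, ← key ψ u]
      exact imp_congr (forall_congr' fun v => imp_congr Iff.rfl (ih₁ v))
        (forall_congr' fun v => imp_congr Iff.rfl (ih₂ v))
    rw [hsat]
    exact ⟨fun h => h (ofConsequences w.prime φ) subset_rfl
      (self_mem_stoConsequences w.prime.isTheory), fun h u hwu => u.mem_of_sto (hwu h)⟩

theorem validFml_em (h : emFml ∈ Ax) : (frame Ax).ValidFml emFml := by
  refine FlatFrame.validFml_em fun (w v : CanonicalWorld Ax) hwv φ hφ => ?_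
  refine (w.prime.mem_or_mem (w.prime.isTheory.subst_mem h fun _ => φ)).resolve_right fun hn => ?_
  exact v.prime.bot_notMem (v.prime.isTheory.mp hφ (hwv hn))

theorem validFml_tb (h : tbFml ∈ Ax) : (frame Ax).ValidFml tbFml :=
  FlatFrame.validFml_tb fun (w : CanonicalWorld Ax) =>
    ⟨ofConsequences w.prime .top, w, subset_rfl, fun φ (hφ : Fml.sto .top φ ∈ w.base) =>
      w.prime.isTheory.mp hφ (w.prime.isTheory.subst_mem h fun _ => φ), subset_rfl⟩

theorem validFml_str (h : strFml ∈ Ax) : (frame Ax).ValidFml strFml := by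
  refine FlatFrame.validFml_str fun (w v : CanonicalWorld Ax) hwv φ hφ => hwv ?_
  exact w.mem_succ_of_top_sto (w.prime.isTheory.mp (w.prime.isTheory.ipc_mp hφ (.k _ _))
    (w.prime.isTheory.subst_mem h fun n => if n = 0 then .top else φ))

theorem validFml_pa (h : paFml ∈ Ax) : (frame Ax).ValidFml paFml := by
  refine FlatFrame.validFml_pa fun (w v v' : CanonicalWorld Ax) hwv hvv' => ?_
  let u : CanonicalWorld Ax :=
    { base := w.base
      succ := v'.succ
      prime := w.prime
      isTheory_succ := v'.isTheory_succ
      mem_of_sto := fun φ ψ hsto => v'.mem_of_sto (hvv' (hwv (w.mem_succ_of_top_sto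
        (w.prime.isTheory.mp hsto
          (w.prime.isTheory.subst_mem h fun n => if n = 0 then φ else ψ))))) }
  exact ⟨u, subset_rfl, fun _ => Iff.rfl⟩

end CanonicalWorld

end Canonical

/-- for `Ax ⊆ {em, t□, str, p_a}`, the logic `HLC♭ ⊕ Ax` is sound
and strongly complete with respect to the class of flat frames validating every
formula of `Ax`. -/
theorem sound_strongly_complete_em_tb_str_pa (Ax : Set Fml)
    (hAx : Ax ⊆ {emFml, tbFml, strFml, paFml}) (Γ : Set Fml) (φ : Fml) :
    Deriv Ax Γ φ ↔
      ∀ F : FlatFrame, (∀ ψ ∈ Ax, F.ValidFml ψ) → F.ValidCons Γ φ := by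
  refine ⟨fun h F hF => FlatFrame.validCons_of_deriv hF h, fun h => ?_⟩
  by_contra hcon
  obtain ⟨Δ, hΓΔ, hΔ, hφ⟩ := exists_isPrimeTheory hcon
  let w := CanonicalWorld.ofConsequences hΔ .top
  have : Nonempty (CanonicalWorld Ax) := ⟨w⟩
  have hvalid : ∀ ψ ∈ Ax, (CanonicalWorld.frame Ax).ValidFml ψ := by
    intro ψ hψ
    rcases hAx hψ with rfl | rfl | rfl | rfl
    · exact CanonicalWorld.validFml_em hψ
    · exact CanonicalWorld.validFml_tb hψ
    · exact CanonicalWorld.validFml_str hψ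
    · exact CanonicalWorld.validFml_pa hψ
  exact hφ ((CanonicalWorld.sat_iff_mem φ w).1 (h _ hvalid CanonicalWorld.val
    (fun _ _ _ hle hp => hle hp) w
    fun ψ hψ => (CanonicalWorld.sat_iff_mem ψ w).2 (hΓΔ hψ)))
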